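/- arXiv:1212.5724 — 7 statements merged into one kernel-verified Lean document; each statement's English description precedes it below -/
import Mathlib

section
/- Let X be a topological space of countable closed pseudocharacter. If player two has a winning strategy in the game G^ω_1(𝒪_X, 𝒪̄_X) of length ω, then X is countable. -/
open Cardinal Set

universe u v

/-- The collection 𝒪_X of all open covers of `X`. -/
def openCovers (X : Type u) [TopologicalSpace X] : Set (Set (Set X)) :=
  {𝒰 | (∀ U ∈ 𝒰, IsOpen U) ∧ ⋃₀ 𝒰 = Set.univ}

/-- The collection 𝒪̄_X of all families of open sets whose closures cover `X`. -/
def closureCovers (X : Type u) [TopologicalSpace X] : Set (Set (Set X)) :=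
  {𝒰 | (∀ U ∈ 𝒰, IsOpen U) ∧ (⋃ U ∈ 𝒰, closure U) = Set.univ}

/-- The collection 𝒟_X of all families of open sets with dense union. -/
def denseFamilies (X : Type u) [TopologicalSpace X] : Set (Set (Set X)) :=
  {𝒰 | (∀ U ∈ 𝒰, IsOpen U) ∧ Dense (⋃₀ 𝒰)}

/-- A cellular family: a family of pairwise disjoint non-empty open sets. -/
def IsCellularFamily (X : Type u) [TopologicalSpace X] (𝒞 : Set (Set X)) : Prop :=
  (∀ U ∈ 𝒞, IsOpen U ∧ U.Nonempty) ∧ 𝒞.PairwiseDisjoint id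

/-- The collection 𝒞_X of all maximal cellular families of `X`. -/
def maximalCellularFamilies (X : Type u) [TopologicalSpace X] : Set (Set (Set X)) :=
  {𝒞 | IsCellularFamily X 𝒞 ∧ ∀ 𝒞' : Set (Set X), IsCellularFamily X 𝒞' → 𝒞 ⊆ 𝒞' → 𝒞' = 𝒞}

/-- Player two has a winning strategy in the game `G^ι_1(A, B)` on the space `X`, where
innings are indexed by the linearly ordered type `ι`: at inning `β` player one plays
`p β ∈ A` and player two, seeing player one's moves up to and including inning `β`, picks an
element of `p β`; player two wins a play if the set of all his choices belongs to `B`. -/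
def P2WinsG1 (X : Type u) [TopologicalSpace X] (ι : Type v) [LinearOrder ι]
    (A B : Set (Set (Set X))) : Prop :=
  ∃ σ : (β : ι) → ({γ : ι // γ ≤ β} → Set (Set X)) → Set X,
    ∀ p : ι → Set (Set X), (∀ β, p β ∈ A) →
      (∀ β, σ β (fun γ => p γ.1) ∈ p β) ∧
      Set.range (fun β => σ β (fun γ => p γ.1)) ∈ B

/-- Player two has a winning strategy in the game `G^ι_fin(A, B)` on the space `X`:
at inning `β` player one plays `p β ∈ A` and player two picks a finite subset of `p β`;
player two wins a play if the union of all his choices belongs to `B`. -/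
def P2WinsGfin (X : Type u) [TopologicalSpace X] (ι : Type v) [LinearOrder ι]
    (A B : Set (Set (Set X))) : Prop :=
  ∃ σ : (β : ι) → ({γ : ι // γ ≤ β} → Set (Set X)) → Set (Set X),
    ∀ p : ι → Set (Set X), (∀ β, p β ∈ A) →
      (∀ β, σ β (fun γ => p γ.1) ⊆ p β ∧ (σ β (fun γ => p γ.1)).Finite) ∧
      {V | ∃ β, V ∈ σ β (fun γ => p γ.1)} ∈ B

/-- `X` has countable closed pseudocharacter: every point has a countable family of open
neighbourhoods the intersection of whose closures is exactly that point. -/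
def CountableClosedPseudocharacter (X : Type u) [TopologicalSpace X] : Prop :=
  ∀ x : X, ∃ 𝒱 : Set (Set X), 𝒱.Countable ∧ (∀ V ∈ 𝒱, IsOpen V ∧ x ∈ V) ∧
    (⋂ V ∈ 𝒱, closure V) = {x}

/-- `X` is almost regular: every non-empty open set contains the closure of a
non-empty open set. -/
def AlmostRegular (X : Type u) [TopologicalSpace X] : Prop :=
  ∀ U : Set X, IsOpen U → U.Nonempty → ∃ V : Set X, IsOpen V ∧ V.Nonempty ∧ closure V ⊆ U

/-- `Y` is relatively H-closed in `X`: every open cover of `X` has a finite subfamily whose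
closures cover `Y`. -/
def RelativelyHClosed (X : Type u) [TopologicalSpace X] (Y : Set X) : Prop :=
  ∀ 𝒰 ∈ openCovers X, ∃ 𝒱 : Set (Set X), 𝒱 ⊆ 𝒰 ∧ 𝒱.Finite ∧ Y ⊆ ⋃ U ∈ 𝒱, closure U

/-- A local π-base at `x`: a family of non-empty open sets such that every open
neighbourhood of `x` contains a member of the family. -/
def IsLocalPiBase (X : Type u) [TopologicalSpace X] (x : X) (B : Set (Set X)) : Prop :=
  (∀ V ∈ B, IsOpen V ∧ V.Nonempty) ∧ ∀ U : Set X, IsOpen U → x ∈ U → ∃ V ∈ B, V ⊆ U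

/-- A π-base of `X`: a family of non-empty open sets such that every non-empty open set
contains a member of the family. -/
def IsPiBase (X : Type u) [TopologicalSpace X] (B : Set (Set X)) : Prop :=
  (∀ V ∈ B, IsOpen V ∧ V.Nonempty) ∧ ∀ U : Set X, IsOpen U → U.Nonempty → ∃ V ∈ B, V ⊆ U

/-- The π-character πχ(X): the least infinite cardinal `κ` such that every point of `X`
has a local π-base of cardinality at most `κ`. -/
noncomputable def piCharacter (X : Type u) [TopologicalSpace X] : Cardinal.{u} :=
  sInf {κ | Cardinal.aleph0 ≤ κ ∧
    ∀ x : X, ∃ B : Set (Set X), Cardinal.mk ↥B ≤ κ ∧ IsLocalPiBase X x B}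

/-- The π-weight πw(X): the least infinite cardinality of a π-base of `X`. -/
noncomputable def piWeight (X : Type u) [TopologicalSpace X] : Cardinal.{u} :=
  sInf {κ | Cardinal.aleph0 ≤ κ ∧ ∃ B : Set (Set X), IsPiBase X B ∧ Cardinal.mk ↥B ≤ κ}

/-- The cellularity c(X): the supremum, together with ℵ₀, of the cardinalities of cellular
families in `X`. -/
noncomputable def cellularity (X : Type u) [TopologicalSpace X] : Cardinal.{u} :=
  max Cardinal.aleph0
    (sSup {κ | ∃ 𝒞 : Set (Set X), IsCellularFamily X 𝒞 ∧ Cardinal.mk ↥𝒞 = κ})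

/-- Countable closed pseudocharacter, with the neighbourhoods of each point enumerated. -/
lemma CountableClosedPseudocharacter.exists_seq {X : Type u} [TopologicalSpace X]
    (h : CountableClosedPseudocharacter X) :
    ∃ V : X → ℕ → Set X, (∀ x n, IsOpen (V x n) ∧ x ∈ V x n) ∧
      ∀ x y, y ≠ x → ∃ n, y ∉ closure (V x n) := by
  have key : ∀ x : X, ∃ V : ℕ → Set X, (∀ n, IsOpen (V n) ∧ x ∈ V n) ∧
      ∀ y, y ≠ x → ∃ n, y ∉ closure (V n) := by
    intro x
    obtain ⟨𝒱, hc, hV, hinter⟩ := h x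
    obtain ⟨V, hr⟩ := (hc.insert Set.univ).exists_eq_range (Set.insert_nonempty _ _)
    refine ⟨V, fun n => ?_, fun y hy => ?_⟩
    · have hn : V n ∈ insert Set.univ 𝒱 := hr ▸ Set.mem_range_self n
      rcases hn with hn | hn
      · simp [hn]
      · exact hV _ hn
    · have hy' : y ∉ ⋂ W ∈ 𝒱, closure W := by rw [hinter]; exact hy
      simp only [Set.mem_iInter, not_forall] at hy'
      obtain ⟨W, hW, hyW⟩ := hy'
      have hWr : W ∈ Set.range V := hr ▸ Set.mem_insert_of_mem _ hW
      obtain ⟨n, rfl⟩ := hWr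
      exact ⟨n, hyW⟩
  choose V hV hV' using key
  exact ⟨V, hV, hV'⟩

/-- The answer of the strategy `σ` to the move `c` after the moves listed in `s`. -/
def strategyAnswer {M N : Type*} (σ : (β : ℕ) → ({γ : ℕ // γ ≤ β} → M) → N)
    (s : List M) (c : M) : N :=
  σ s.length fun γ => (s ++ [c]).getD γ.1 c

lemma strategyAnswer_map_range {M N : Type*} (σ : (β : ℕ) → ({γ : ℕ // γ ≤ β} → M) → N)
    (p : ℕ → M) (k : ℕ) :
    strategyAnswer σ ((List.range k).map p) (p k) = σ k fun γ => p γ.1 := by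
  have aux : ∀ m, m = k →
      (σ m fun γ => ((List.range (k + 1)).map p).getD γ.1 (p k)) = σ k fun γ => p γ.1 := by
    rintro m rfl
    congr 1
    funext γ
    have : γ.1 < m + 1 := Nat.lt_succ_of_le γ.2
    simp [List.getD_eq_getElem?_getD, this]
  have h1 : (List.range k).map p ++ [p k] = (List.range (k + 1)).map p := by
    simp [List.range_succ]
  unfold strategyAnswer
  rw [h1]
  exact aux _ (by simp)

/-- After any finite sequence of open covers, some point has the property that each of its open
neighbourhoods is the answer of the strategy to some open cover. -/
lemma exists_forall_nhds_eq_strategyAnswer {X : Type u} [TopologicalSpace X]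
    {σ : (β : ℕ) → ({γ : ℕ // γ ≤ β} → Set (Set X)) → Set X}
    (hσ : ∀ p : ℕ → Set (Set X), (∀ β, p β ∈ openCovers X) →
      ∀ β, σ β (fun γ => p γ.1) ∈ p β)
    {s : List (Set (Set X))} (hs : ∀ c ∈ s, c ∈ openCovers X) :
    ∃ x : X, ∀ U, IsOpen U → x ∈ U → ∃ c ∈ openCovers X, strategyAnswer σ s c = U := by
  by_contra! hcon
  choose U hU hxU hne using hcon
  have hc : Set.range U ∈ openCovers X := by
    refine ⟨?_, Set.eq_univ_of_forall fun x => ⟨U x, ⟨x, rfl⟩, hxU x⟩⟩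
    rintro _ ⟨x, rfl⟩
    exact hU x
  have hmem := hσ (fun n => (s ++ [Set.range U]).getD n (Set.range U)) (fun n => by
    rcases lt_or_ge n (s ++ [Set.range U]).length with hn | hn
    · rw [List.getD_eq_getElem _ _ hn]
      have := List.getElem_mem hn
      rcases List.mem_append.1 this with h | h
      · exact hs _ h
      · rw [List.mem_singleton.1 h]; exact hc
    · rw [List.getD_eq_default _ _ hn]; exact hc) s.length
  have hmem' : strategyAnswer σ s (Set.range U) ∈ Set.range U := by
    simpa [strategyAnswer] using hmem
  obtain ⟨x, hx⟩ := hmem'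
  exact hne x _ hc hx.symm

theorem stmt_4 {X : Type u} [TopologicalSpace X]
    (hψ : CountableClosedPseudocharacter X)
    (hwin : P2WinsG1 X ℕ (openCovers X) (closureCovers X)) :
    Countable X := by
  obtain ⟨V, hV, hsep⟩ := hψ.exists_seq
  obtain ⟨σ, hσ⟩ := hwin
  have hlegal := fun p hp => (hσ p hp).1
  let Pos := {s : List (Set (Set X)) // ∀ c ∈ s, c ∈ openCovers X}
  have hpt : ∀ s : Pos, ∃ x : X, ∀ U, IsOpen U → x ∈ U →
      ∃ c ∈ openCovers X, strategyAnswer σ s.1 c = U :=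
    fun s => exists_forall_nhds_eq_strategyAnswer hlegal s.2
  choose x hx using hpt
  have hmv : ∀ (s : Pos) (n : ℕ), ∃ c ∈ openCovers X,
      strategyAnswer σ s.1 c = V (x s) n :=
    fun s n => hx s _ (hV _ n).1 (hV _ n).2
  choose move hmove hans using hmv
  let extend : ℕ → Pos → Pos := fun n s => ⟨s.1 ++ [move s n], fun c hc => by
    rcases List.mem_append.1 hc with h | h
    · exact s.2 c h
    · rw [List.mem_singleton.1 h]; exact hmove s n⟩
  let node : List ℕ → Pos := List.foldr extend ⟨[], by simp⟩
  suffices hsurj : Function.Surjective fun l => x (node l) from hsurj.countable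
  intro y
  by_contra! hy
  choose f hf using fun l => hsep (x (node l)) y (hy l).symm
  let L : ℕ → List ℕ := fun k => Nat.rec [] (fun _ l => f l :: l) k
  let p : ℕ → Set (Set X) := fun k => move (node (L k)) (f (L k))
  have hnode : ∀ k, (node (L k)).1 = (List.range k).map p := by
    intro k
    induction k with
    | zero => rfl
    | succ k ih =>
      rw [List.range_succ, List.map_append, ← ih]
      rfl
  have hcover := (hσ p fun k => hmove _ _).2.2
  have hyc := hcover.symm ▸ Set.mem_univ y
  simp only [Set.mem_iUnion] at hyc
  obtain ⟨_, ⟨k, rfl⟩, hk⟩ := hyc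
  apply hf (L k)
  rw [← hans, hnode, show move (node (L k)) (f (L k)) = p k from rfl, strategyAnswer_map_range]
  exact hk
end

section
/- Let X be a first-countable almost regular topological space. If player two has a winning strategy in the game G^ω_1(𝒪_X, 𝒟_X) of length ω, then X is separable. -/
open Cardinal Set

universe u v

/-- Galvin's argument: if `f` picks an element of each open cover, then every open neighbourhood
of some point is picked from some open cover. -/
theorem exists_point_forall_nhds_eq_selection {X : Type u} [TopologicalSpace X]
    (f : openCovers X → Set X) (hf : ∀ 𝒰, f 𝒰 ∈ 𝒰.1) :
    ∃ x : X, ∀ U : Set X, IsOpen U → x ∈ U → ∃ 𝒰, f 𝒰 = U := by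
  by_contra! hcon
  choose U hUo hxU hU using hcon
  have hcover : Set.range U ∈ openCovers X := by
    refine ⟨?_, Set.eq_univ_of_forall fun x => ⟨U x, ⟨x, rfl⟩, hxU x⟩⟩
    rintro _ ⟨x, rfl⟩
    exact hUo x
  obtain ⟨x, hx⟩ := hf ⟨_, hcover⟩
  exact hU x _ hx.symm

/-- The history of a play obtained by following the list `l` of numbers (latest first) in a
countably branching tree: `step n h k` is the move in inning `n`, after the history `h`, that
corresponds to the `k`-th branch. Innings from `l.length` on hold the filler `d`. -/
def branchHistory {α : Type v} (d : α) (step : ℕ → (ℕ → α) → ℕ → α) : List ℕ → ℕ → α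
  | [] => fun _ => d
  | k :: l => Function.update (branchHistory d step l) l.length
      (step l.length (branchHistory d step l) k)

/-- The initial segment of length `n` (latest first) of the branch chosen by `k`. -/
def branchPrefix (k : List ℕ → ℕ) : ℕ → List ℕ
  | 0 => []
  | n + 1 => k (branchPrefix k n) :: branchPrefix k n

theorem length_branchPrefix (k : List ℕ → ℕ) (n : ℕ) : (branchPrefix k n).length = n := by
  induction n with
  | zero => rfl
  | succ n ih => simp [branchPrefix, ih]

theorem branchHistory_branchPrefix_of_lt {α : Type v} (d : α) (step : ℕ → (ℕ → α) → ℕ → α)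
    (k : List ℕ → ℕ) {i n : ℕ} (hi : i < n) :
    branchHistory d step (branchPrefix k n) i =
      branchHistory d step (branchPrefix k (i + 1)) i := by
  induction n, hi using Nat.le_induction with
  | base => rfl
  | succ n hn ih =>
    rw [← ih, branchPrefix, branchHistory, length_branchPrefix,
      Function.update_of_ne (by omega)]

theorem stmt_5 {X : Type u} [TopologicalSpace X]
    [FirstCountableTopology X] (hreg : AlmostRegular X)
    (hwin : P2WinsG1 X ℕ (openCovers X) (denseFamilies X)) :
    TopologicalSpace.SeparableSpace X := by
  obtain ⟨σ, hσ⟩ := hwin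
  have hpoint (n : ℕ) (h : ℕ → openCovers X) : ∃ x : X, ∀ U : Set X, IsOpen U → x ∈ U →
      ∃ 𝒰, σ n (fun γ => (Function.update h n 𝒰 γ.1).1) = U := by
    refine exists_point_forall_nhds_eq_selection _ fun 𝒰 => ?_
    simpa using (hσ (fun i => (Function.update h n 𝒰 i).1) fun i => Subtype.property _).1 n
  choose x hx using hpoint
  have hbasis (y : X) : ∃ B : ℕ → Set X, (∀ k, y ∈ B k ∧ IsOpen (B k)) ∧
      (nhds y).HasAntitoneBasis B := (nhds_basis_opens y).exists_antitone_subbasis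
  choose B hB hBbasis using hbasis
  choose step hstep using fun n h k => hx n h (B (x n h) k) (hB _ k).2 (hB _ k).1
  let d : openCovers X := ⟨{Set.univ}, by simp [openCovers]⟩
  let H := branchHistory d step
  let D : Set X := Set.range fun l : List ℕ => x l.length (H l)
  refine ⟨D, Set.countable_range _, ?_⟩
  by_contra hD
  obtain ⟨V, hVo, hVne, hV⟩ := hreg (closure D)ᶜ isClosed_closure.isOpen_compl
    (Set.nonempty_compl.2 fun h => hD (dense_iff_closure_eq.2 h))
  have havoid (l : List ℕ) : ∃ k, B (x l.length (H l)) k ⊆ (closure V)ᶜ := by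
    have hl : x l.length (H l) ∈ (closure V)ᶜ :=
      fun h => hV h (subset_closure ⟨l, rfl⟩)
    obtain ⟨k, -, hk⟩ := (hBbasis _).toHasBasis.mem_iff.1
      (isClosed_closure.isOpen_compl.mem_nhds hl)
    exact ⟨k, hk⟩
  choose k hk using havoid
  let p (n : ℕ) : openCovers X := H (branchPrefix k (n + 1)) n
  have hresponse (n : ℕ) : σ n (fun γ => (p γ.1).1) ⊆ (closure V)ᶜ := by
    have hp : (fun γ : {γ : ℕ // γ ≤ n} => (p γ.1).1) =
        fun γ => (H (branchPrefix k (n + 1)) γ.1).1 := by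
      funext γ
      exact congrArg Subtype.val
        (branchHistory_branchPrefix_of_lt d step k (Nat.lt_succ_of_le γ.2)).symm
    have hmove := hstep n (H (branchPrefix k n)) (k (branchPrefix k n))
    have hsub := hk (branchPrefix k n)
    rw [length_branchPrefix] at hsub
    have hH : H (branchPrefix k (n + 1)) = Function.update (H (branchPrefix k n)) n
        (step n (H (branchPrefix k n)) (k (branchPrefix k n))) := by
      simp only [H, branchPrefix, branchHistory, length_branchPrefix]
    rw [hp, hH, hmove]
    exact hsub
  obtain ⟨y, hyV, _, ⟨n, rfl⟩, hy⟩ :=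
    (hσ (fun n => (p n).1) fun n => (p n).2).2.2.inter_open_nonempty V hVo hVne
  exact hresponse n hy (subset_closure hyV)
end

section
/- If a topological space X is the union of countably many subsets, each of which is relatively H-closed in X, then player two has a winning strategy in the game G^ω_fin(𝒪_X, 𝒪̄_X). -/
open Cardinal Set

universe u v

theorem stmt_9 {X : Type u} [TopologicalSpace X] (Y : ℕ → Set X)
    (hH : ∀ n, RelativelyHClosed X (Y n)) (hcov : (⋃ n, Y n) = Set.univ) :
    P2WinsGfin X ℕ (openCovers X) (closureCovers X) := by
  choose! F hsub hfin hcl using hH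
  refine ⟨fun n q => F n (q ⟨n, le_rfl⟩), fun p hp =>
    ⟨fun n => ⟨hsub n _ (hp n), hfin n _ (hp n)⟩, ?_, ?_⟩⟩
  · rintro U ⟨n, hU⟩
    exact (hp n).1 U (hsub n _ (hp n) hU)
  · refine Set.eq_univ_of_forall fun x => ?_
    obtain ⟨n, hn⟩ := Set.mem_iUnion.1 (hcov ▸ Set.mem_univ x)
    obtain ⟨U, hU, hx⟩ := Set.mem_iUnion₂.1 (hcl n _ (hp n) hn)
    exact Set.mem_iUnion₂.2 ⟨U, ⟨n, hU⟩, hx⟩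
end

section
/- If a topological space X contains a dense subspace which is the union of countably many subsets, each relatively H-closed in X, then player two has a winning strategy in the game G^ω_fin(𝒪_X, 𝒟_X). -/
open Cardinal Set

universe u v

theorem stmt_10 {X : Type u} [TopologicalSpace X] (Y : ℕ → Set X)
    (hH : ∀ n, RelativelyHClosed X (Y n)) (hdense : Dense (⋃ n, Y n)) :
    P2WinsGfin X ℕ (openCovers X) (denseFamilies X) := by
  classical
  choose F hsub hfin hcov using hH
  refine ⟨fun n h => if hc : h ⟨n, le_rfl⟩ ∈ openCovers X then F n _ hc else ∅, fun p hp => ?_⟩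
  simp only [hp, dif_pos]
  refine ⟨fun n => ⟨hsub n _ (hp n), hfin n _ (hp n)⟩, ?_, ?_⟩
  · rintro V ⟨n, hV⟩
    exact (hp n).1 V (hsub n _ (hp n) hV)
  · refine dense_closure.1 (hdense.mono (iUnion_subset fun n => (hcov n _ (hp n)).trans ?_))
    exact iUnion₂_subset fun U hU => closure_mono (subset_sUnion_of_mem ⟨n, hU⟩)
end

section
/- Let X be an almost regular topological space. Then the π-weight of X satisfies πw(X) ≤ πχ(X)^{c(X)}, where πχ(X) is the π-character and c(X) the cellularity of X. -/
open Cardinal Set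

universe u v

theorem piCharacter_spec (X : Type u) [TopologicalSpace X] :
    ℵ₀ ≤ piCharacter X ∧
      ∀ x : X, ∃ B : Set (Set X), #B ≤ piCharacter X ∧ IsLocalPiBase X x B := by
  refine csInf_mem (s := {κ : Cardinal.{u} | ℵ₀ ≤ κ ∧
    ∀ x : X, ∃ B : Set (Set X), #B ≤ κ ∧ IsLocalPiBase X x B}) ?_
  refine ⟨max ℵ₀ #(Set X), le_max_left _ _, fun x => ?_⟩
  exact ⟨{V | IsOpen V ∧ V.Nonempty}, (mk_set_le _).trans (le_max_right _ _), fun V hV => hV,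
    fun U hU hx => ⟨U, ⟨hU, x, hx⟩, subset_rfl⟩⟩

theorem IsCellularFamily.mk_le_cellularity {X : Type u} [TopologicalSpace X]
    {𝒞 : Set (Set X)} (h : IsCellularFamily X 𝒞) : #𝒞 ≤ cellularity X := by
  refine le_max_of_le_right (le_csSup ?_ ⟨𝒞, h, rfl⟩)
  refine ⟨#(Set X), ?_⟩
  rintro _ ⟨𝒟, -, rfl⟩
  exact mk_set_le _

theorem piWeight_le {X : Type u} [TopologicalSpace X] {B : Set (Set X)} {κ : Cardinal.{u}}
    (hκ : ℵ₀ ≤ κ) (hB : IsPiBase X B) (hBκ : #B ≤ κ) : piWeight X ≤ κ :=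
  csInf_le' ⟨hκ, B, hB, hBκ⟩

/-- A nonempty set of cardinality at most that of `ι` is the range of a family indexed by `ι`. -/
theorem exists_range_eq_of_mk_le {α ι : Type u} {s : Set α} (hs : s.Nonempty) (h : #s ≤ #ι) :
    ∃ f : ι → α, range f = s := by
  have := hs.to_subtype
  obtain ⟨e⟩ := h
  refine ⟨fun i => (Function.invFun e i : s), ?_⟩
  rw [range_comp' Subtype.val (Function.invFun e),
    (Function.invFun_surjective e.injective).range_eq, image_univ, Subtype.range_val]

/-- A set of points of cardinality at most `#K ^ #L`, parametrised by `T`, which is closed under the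
choice function `p` applied to the families of at most `#L` of the sets `b x k` with `x` in this set of points. -/
theorem exists_closed_parametrization {X K L : Type u} (hK : ℵ₀ ≤ #K) (hL : ℵ₀ ≤ #L)
    (b : X → K → Set X) (p : Set (Set X) → X) :
    ∃ (T : Type u) (e : T → X), #T ≤ #K ^ #L ∧
      ∀ 𝒱 : Set (Set X), 𝒱 ⊆ range (fun q : T × K => b (e q.1) q.2) → #𝒱 ≤ #L →
        p 𝒱 ∈ range e := by
  let β : Option (L → K) → Type u := fun a => a.elim PEmpty fun _ => L
  let e : WType β → X := WType.elim X fun q => match q with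
    | ⟨none, _⟩ => p ∅
    | ⟨some a, g⟩ => p (range fun l => b (g l) (a l))
  have hinf : ℵ₀ ≤ #K ^ #L := hK.trans (self_le_power _ (one_le_aleph0.trans hL))
  refine ⟨WType β, e, WType.cardinalMk_le_of_le ?_, fun 𝒱 h𝒱 hcard => ?_⟩
  · have hpow : (#K ^ #L) ^ #L = #K ^ #L := by rw [← power_mul, mul_eq_self hL]
    refine (sum_le_mk_mul_iSup _).trans ?_
    refine (mul_le_mul' (b := #K ^ #L) (d := #K ^ #L) ?_ (ciSup_le' fun a => ?_)).trans
      (mul_eq_self hinf).le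
    · rw [mk_option]
      exact add_le_of_le hinf (by simp) (one_le_aleph0.trans hinf)
    · cases a with
      | none => simpa [β] using one_le_aleph0.trans hinf
      | some a => exact hpow.le
  · rcases 𝒱.eq_empty_or_nonempty with rfl | hne
    · exact ⟨WType.mk none PEmpty.elim, rfl⟩
    · obtain ⟨f, rfl⟩ := exists_range_eq_of_mk_le hne hcard
      choose q hq using fun l => h𝒱 (mem_range_self l)
      refine ⟨WType.mk (some fun l => (q l).2) fun l => (q l).1, ?_⟩
      change p (range fun l => b (e (q l).1) (q l).2) = p (range f)
      exact congrArg (fun g => p (range g)) (funext hq)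

/-- A maximal disjoint subfamily of `B` meets every nonempty member of `B`. -/
theorem exists_maximal_pairwiseDisjoint {X : Type u} (B : Set (Set X)) :
    ∃ 𝒱 ⊆ B, 𝒱.PairwiseDisjoint id ∧
      ∀ W ∈ B, W.Nonempty → (∀ V ∈ 𝒱, Disjoint W V) → False := by
  obtain ⟨𝒱, hmax⟩ := zorn_subset {𝒱 : Set (Set X) | 𝒱 ⊆ B ∧ 𝒱.PairwiseDisjoint id}
    fun c hc hchain => ⟨⋃₀ c, ⟨sUnion_subset fun 𝒱 h => (hc h).1,
      (pairwiseDisjoint_sUnion hchain.directedOn).2 fun 𝒱 h => (hc h).2⟩,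
      fun 𝒱 h => subset_sUnion_of_mem h⟩
  refine ⟨𝒱, hmax.prop.1, hmax.prop.2, fun W hW hne hdisj => ?_⟩
  have hmem : W ∈ 𝒱 := hmax.le_of_ge
    ⟨insert_subset hW hmax.prop.1, hmax.prop.2.insert fun V hV _ => hdisj V hV⟩
    (subset_insert W 𝒱) (mem_insert W 𝒱)
  exact hne.ne_empty (disjoint_self.1 (hdisj W hmem))

theorem isPiBase_of_closed {X : Type u} [TopologicalSpace X] (hreg : AlmostRegular X)
    {A : Set X} {B : X → Set (Set X)} (hB : ∀ x, IsLocalPiBase X x (B x))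
    (hA : ∀ 𝒱 ⊆ ⋃ x ∈ A, B x, IsCellularFamily X 𝒱 → ¬ Dense (⋃₀ 𝒱) →
      ∃ x ∈ A, x ∉ closure (⋃₀ 𝒱)) :
    IsPiBase X (⋃ x ∈ A, B x) := by
  have hBA : ∀ V ∈ ⋃ x ∈ A, B x, IsOpen V ∧ V.Nonempty := by
    intro V hV
    obtain ⟨x, -, hx⟩ := mem_iUnion₂.1 hV
    exact (hB x).1 V hx
  refine ⟨hBA, fun U hU hne => ?_⟩
  obtain ⟨V, hVo, hVne, hVU⟩ := hreg U hU hne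
  obtain ⟨𝒱, h𝒱, hdisj, hmax⟩ :=
    exists_maximal_pairwiseDisjoint {W ∈ ⋃ x ∈ A, B x | Disjoint V W}
  have hdV : Disjoint V (⋃₀ 𝒱) := disjoint_sUnion_right.2 fun W hW => (h𝒱 hW).2
  have hnd : ¬ Dense (⋃₀ 𝒱) := fun hd =>
    (hd.inter_open_nonempty V hVo hVne).ne_empty hdV.inter_eq
  obtain ⟨x, hxA, hx⟩ := hA 𝒱 (fun W hW => (h𝒱 hW).1)
    ⟨fun W hW => hBA W (h𝒱 hW).1, hdisj⟩ hnd
  by_cases hxU : x ∈ U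
  · obtain ⟨W, hW, hWU⟩ := (hB x).2 U hU hxU
    exact ⟨W, mem_biUnion hxA hW, hWU⟩
  · obtain ⟨W, hW, hWsub⟩ := (hB x).2 ((closure V)ᶜ ∩ (closure (⋃₀ 𝒱))ᶜ)
      (isClosed_closure.isOpen_compl.inter isClosed_closure.isOpen_compl)
      ⟨fun h => hxU (hVU h), hx⟩
    refine (hmax W ⟨mem_biUnion hxA hW, ?_⟩ ((hB x).1 W hW).2 fun W' hW' => ?_).elim
    · exact disjoint_right.2 fun y hy hyV => (hWsub hy).1 (subset_closure hyV)
    · exact disjoint_left.2 fun y hy hyW' =>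
        (hWsub hy).2 (subset_closure (mem_sUnion_of_mem hyW' hW'))

theorem stmt_14 {X : Type u} [TopologicalSpace X] (hreg : AlmostRegular X) :
    piWeight X ≤ piCharacter X ^ cellularity X := by
  obtain ⟨hχ, hbase⟩ := piCharacter_spec X
  have hc : ℵ₀ ≤ cellularity X := le_max_left _ _
  have hinf : ℵ₀ ≤ piCharacter X ^ cellularity X :=
    hχ.trans (self_le_power _ (one_le_aleph0.trans hc))
  rcases isEmpty_or_nonempty X with hX | hX
  · refine piWeight_le (B := ∅) hinf ⟨fun _ hV => hV.elim, fun U _ hU => ?_⟩ (by simp)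
    exact hX.elim hU.some
  have hfam : ∀ x : X, ∃ b : (piCharacter X).out → Set X, IsLocalPiBase X x (range b) := by
    intro x
    obtain ⟨B, hcard, hB⟩ := hbase x
    obtain ⟨V, hV, -⟩ := hB.2 univ isOpen_univ (mem_univ x)
    obtain ⟨b, rfl⟩ := exists_range_eq_of_mk_le (ι := (piCharacter X).out) ⟨V, hV⟩ (by simpa)
    exact ⟨b, hB⟩
  choose b hb using hfam
  have hpoint : ∀ 𝒱 : Set (Set X), ∃ x, ¬ Dense (⋃₀ 𝒱) → x ∉ closure (⋃₀ 𝒱) := by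
    intro 𝒱
    by_cases h : Dense (⋃₀ 𝒱)
    · exact ⟨Classical.arbitrary X, fun h' => (h' h).elim⟩
    · obtain ⟨x, hx⟩ := not_forall.1 h
      exact ⟨x, fun _ => hx⟩
  choose p hp using hpoint
  obtain ⟨T, e, hT, hclosed⟩ := exists_closed_parametrization
    (K := (piCharacter X).out) (L := (cellularity X).out) (by simpa) (by simpa) b p
  rw [mk_out, mk_out] at hT
  have hrange : ⋃ x ∈ range e, range (b x) = range fun q : T × (piCharacter X).out =>
      b (e q.1) q.2 := by
    ext V
    simp
  refine piWeight_le (B := ⋃ x ∈ range e, range (b x)) hinf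
    (isPiBase_of_closed hreg hb fun 𝒱 h𝒱 hcell hnd => ?_) ?_
  · exact ⟨p 𝒱, hclosed 𝒱 (hrange ▸ h𝒱) (by simpa using hcell.mk_le_cellularity), hp 𝒱 hnd⟩
  · rw [hrange]
    refine mk_range_le.trans ?_
    rw [mk_prod, lift_id, lift_id, mk_out]
    exact (mul_le_mul' hT (self_le_power _ (one_le_aleph0.trans hc))).trans
      (mul_eq_self hinf).le
end

section
/- Let X be an almost regular topological space of countable π-character. If player two has a winning strategy in the game G^ω_1(𝒞_X, 𝒟_X), then X has a countable π-base. -/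
open Cardinal Set

universe u v

/-- Every π-base contains a maximal cellular family. -/
theorem IsPiBase.exists_subset_maximalCellular {X : Type u} [TopologicalSpace X]
    {G : Set (Set X)} (hG : IsPiBase X G) :
    ∃ C ∈ maximalCellularFamilies X, C ⊆ G := by
  obtain ⟨C, hC⟩ := zorn_subset {C : Set (Set X) | C ⊆ G ∧ C.PairwiseDisjoint id} (by
    intro c hc hchain
    refine ⟨⋃₀ c, ⟨sUnion_subset fun s hs => (hc hs).1, ?_⟩, fun s hs => subset_sUnion_of_mem hs⟩
    exact (pairwiseDisjoint_sUnion hchain.directedOn).2 fun s hs => (hc hs).2)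
  refine ⟨C, ⟨⟨fun U hU => hG.1 U (hC.prop.1 hU), hC.prop.2⟩, ?_⟩, hC.prop.1⟩
  intro C' hC' hsub
  refine Subset.antisymm (fun U hU => ?_) hsub
  by_contra hUC
  obtain ⟨hUo, hUne⟩ := hC'.1 U hU
  obtain ⟨W, hWG, hWU⟩ := hG.2 U hUo hUne
  have hins : insert W C ∈ {C : Set (Set X) | C ⊆ G ∧ C.PairwiseDisjoint id} := by
    refine ⟨insert_subset hWG hC.prop.1, hC.prop.2.insert fun V hV _ => ?_⟩
    exact (hC'.2 hU (hsub hV) fun h => hUC (h ▸ hV)).mono_left hWU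
  have hWC : W ∈ C := hC.le_of_ge hins (subset_insert W C) (mem_insert W C)
  obtain ⟨y, hy⟩ := (hG.1 W hWG).2
  have hne : W ≠ U := fun h => hUC (h ▸ hWC)
  exact Set.disjoint_left.1 (hC'.2 (hsub hWC) hU hne) hy (hWU hy)

/-- If a choice of an element of each maximal cellular family is given and every point has a
countable local π-base, then some point has a local π-base enumerated by chosen elements. -/
theorem exists_isLocalPiBase_range_response {X : Type u} [TopologicalSpace X]
    (hπχ : ∀ x : X, ∃ B : Set (Set X), B.Countable ∧ IsLocalPiBase X x B)
    (r : maximalCellularFamilies X → Set X) (hr : ∀ C, r C ∈ C.1) :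
    ∃ (x : X) (e : ℕ → maximalCellularFamilies X),
      IsLocalPiBase X x (Set.range fun k => r (e k)) := by
  obtain ⟨U, hUo, ⟨x, hxU⟩, hU⟩ : ∃ U : Set X, IsOpen U ∧ U.Nonempty ∧
      ∀ W ⊆ U, IsOpen W → W.Nonempty → ∃ C, r C = W := by
    by_contra! hcon
    have hG : IsPiBase X {W | (IsOpen W ∧ W.Nonempty) ∧ ∀ C, r C ≠ W} := by
      refine ⟨fun W hW => hW.1, fun U hUo hUne => ?_⟩
      obtain ⟨W, hWU, hWo, hWne, hW⟩ := hcon U hUo hUne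
      exact ⟨W, ⟨⟨hWo, hWne⟩, hW⟩, hWU⟩
    obtain ⟨C, hC, hCG⟩ := hG.exists_subset_maximalCellular
    exact (hCG (hr ⟨C, hC⟩)).2 ⟨C, hC⟩ rfl
  obtain ⟨B, hBc, hB⟩ := hπχ x
  have hne : {W ∈ B | W ⊆ U}.Nonempty := by
    obtain ⟨V, hV, hVU⟩ := hB.2 U hUo hxU
    exact ⟨V, hV, hVU⟩
  obtain ⟨g, hg⟩ := (hBc.mono (sep_subset B fun W => W ⊆ U)).exists_eq_range hne
  have hgmem : ∀ k, g k ∈ B ∧ g k ⊆ U := fun k => by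
    have : g k ∈ {W ∈ B | W ⊆ U} := hg ▸ mem_range_self k
    exact this
  choose e he using fun k => hU (g k) (hgmem k).2 (hB.1 _ (hgmem k).1).1 (hB.1 _ (hgmem k).1).2
  refine ⟨x, e, ?_, fun O hO hxO => ?_⟩
  · rintro _ ⟨k, rfl⟩
    simpa only [he] using hB.1 _ (hgmem k).1
  · obtain ⟨V, hV, hVO⟩ := hB.2 (O ∩ U) (hO.inter hUo) ⟨hxO, hxU⟩
    have hVg : V ∈ Set.range g := hg ▸ ⟨hV, hVO.trans inter_subset_right⟩
    obtain ⟨k, rfl⟩ := hVg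
    exact ⟨r (e k), mem_range_self k, (he k).trans_subset (hVO.trans inter_subset_left)⟩

/-- The sequence of moves obtained from `p` by overwriting the first `l.length` entries
according to `e` along the finite sequence `l` (most recent entry first). -/
def overwriteAlong {A : Type v} (p : ℕ → A) (e : (ℕ → A) → ℕ → ℕ → A) : List ℕ → ℕ → A
  | [] => p
  | k :: l => Function.update (overwriteAlong p e l) l.length (e (overwriteAlong p e l) l.length k)

/-- The first `n` steps, most recent first, of the branch that extends `l` by `f l`. -/
def branchUpTo (f : List ℕ → ℕ) : ℕ → List ℕ
  | 0 => []
  | n + 1 => f (branchUpTo f n) :: branchUpTo f n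

theorem length_branchUpTo (f : List ℕ → ℕ) (n : ℕ) : (branchUpTo f n).length = n := by
  induction n with
  | zero => rfl
  | succ n ih => simp [branchUpTo, ih]

theorem overwriteAlong_branchUpTo_of_lt {A : Type v} (p : ℕ → A) (e : (ℕ → A) → ℕ → ℕ → A)
    (f : List ℕ → ℕ) {i n : ℕ} (h : i < n) :
    overwriteAlong p e (branchUpTo f n) i = overwriteAlong p e (branchUpTo f (i + 1)) i := by
  induction n, h using Nat.le_induction with
  | base => rfl
  | succ n hn ih =>
    rw [← ih, branchUpTo, overwriteAlong, length_branchUpTo,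
      Function.update_of_ne (Nat.ne_of_lt hn)]

theorem stmt_15 {X : Type u} [TopologicalSpace X] (hreg : AlmostRegular X)
    (hπχ : ∀ x : X, ∃ B : Set (Set X), B.Countable ∧ IsLocalPiBase X x B)
    (hwin : P2WinsG1 X ℕ (maximalCellularFamilies X) (denseFamilies X)) :
    ∃ B : Set (Set X), B.Countable ∧ IsPiBase X B := by
  obtain ⟨σ, hσ⟩ := hwin
  obtain ⟨C₀, hC₀, -⟩ := IsPiBase.exists_subset_maximalCellular
    (G := {W : Set X | IsOpen W ∧ W.Nonempty})
    ⟨fun W hW => hW, fun U hU hne => ⟨U, ⟨hU, hne⟩, Subset.rfl⟩⟩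
  let r (n : ℕ) (p : ℕ → maximalCellularFamilies X) : Set X := σ n fun γ => (p γ.1).1
  have hr (n : ℕ) (p : ℕ → maximalCellularFamilies X) : r n p ∈ (p n).1 :=
    (hσ (fun i => (p i).1) fun i => (p i).2).1 n
  have key (p : ℕ → maximalCellularFamilies X) (n : ℕ) :
      ∃ (x : X) (e : ℕ → maximalCellularFamilies X),
        IsLocalPiBase X x (Set.range fun k => r n (Function.update p n (e k))) :=
    exists_isLocalPiBase_range_response hπχ (fun C => r n (Function.update p n C)) fun C => by
      simpa using hr n (Function.update p n C)
  choose x e he using key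
  let q : List ℕ → ℕ → maximalCellularFamilies X := overwriteAlong (fun _ => ⟨C₀, hC₀⟩) e
  have hq (l : List ℕ) : IsLocalPiBase X (x (q l) l.length)
      (Set.range fun k => r l.length (q (k :: l))) := he (q l) l.length
  refine ⟨⋃ l : List ℕ, Set.range fun k => r l.length (q (k :: l)),
    countable_iUnion fun l => countable_range _, ?_, fun O hO hOne => ?_⟩
  · intro V hV
    obtain ⟨l, hl⟩ := mem_iUnion.1 hV
    exact (hq l).1 V hl
  by_contra! hcon
  obtain ⟨V, hVo, hVne, hVO⟩ := hreg O hO hOne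
  have hstep (l : List ℕ) : ∃ k, Disjoint (r l.length (q (k :: l))) V := by
    have hx : x (q l) l.length ∈ (closure V)ᶜ := fun hmem => by
      obtain ⟨W, hW, hWO⟩ := (hq l).2 O hO (hVO hmem)
      exact hcon W (mem_iUnion.2 ⟨l, hW⟩) hWO
    obtain ⟨_, ⟨k, rfl⟩, hk⟩ := (hq l).2 _ isClosed_closure.isOpen_compl hx
    exact ⟨k, (disjoint_left.2 fun y hy hyV => hk hy (subset_closure hyV))⟩
  choose f hf using hstep
  let p (i : ℕ) : maximalCellularFamilies X := q (branchUpTo f (i + 1)) i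
  have hp (n : ℕ) : Disjoint (r n p) V := by
    have hn := hf (branchUpTo f n)
    rw [length_branchUpTo] at hn
    convert hn using 1
    refine congrArg (σ n) (funext fun γ => congrArg Subtype.val ?_)
    exact (overwriteAlong_branchUpTo_of_lt _ e f (Nat.lt_succ_of_le γ.2)).symm
  have hdense := (hσ (fun i => (p i).1) fun i => (p i).2).2.2
  obtain ⟨y, hyV, _, ⟨n, rfl⟩, hy⟩ := hdense.inter_open_nonempty V hVo hVne
  exact disjoint_left.1 (hp n) hy hyV
end

section
/- Let {X_i : i ∈ I} be a family of regular topological spaces, each of countable π-character, such that for every i ∈ I player two has a winning strategy in the game G^ω_1(𝒞_{X_i}, 𝒟_{X_i}), and let X = ∏_{i ∈ I} X_i with the product topology. Then player two has a winning strategy in the game G^ω_1(𝒞_X, 𝒟_X). -/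
open Cardinal Set

universe u v

/-- If the open sets belonging to `𝒱` form a π-base, some maximal cellular family consists of
members of `𝒱`. -/
theorem exists_maximalCellularFamily_subset {X : Type u} [TopologicalSpace X]
    (𝒱 : Set (Set X)) (hV : ∀ V ∈ 𝒱, IsOpen V ∧ V.Nonempty)
    (hpi : ∀ U : Set X, IsOpen U → U.Nonempty → ∃ V ∈ 𝒱, V ⊆ U) :
    ∃ C ∈ maximalCellularFamilies X, C ⊆ 𝒱 := by
  obtain ⟨C, hC⟩ := zorn_subset {C : Set (Set X) | C ⊆ 𝒱 ∧ C.PairwiseDisjoint id} (by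
    intro c hc hchain
    refine ⟨⋃₀ c, ⟨sUnion_subset fun s hs => (hc hs).1, ?_⟩, fun s hs => subset_sUnion_of_mem hs⟩
    exact (Set.pairwiseDisjoint_sUnion hchain.directedOn).2 fun s hs => (hc hs).2)
  obtain ⟨⟨hCV, hdisj⟩, hmax⟩ := hC
  refine ⟨C, ⟨⟨fun U hU => hV U (hCV hU), hdisj⟩, fun C' hC' hsub => ?_⟩, hCV⟩
  refine Subset.antisymm (fun U hU => ?_) hsub
  by_contra hUC
  obtain ⟨V, hV𝒱, hVU⟩ := hpi U (hC'.1 U hU).1 (hC'.1 U hU).2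
  have hUd : ∀ W ∈ C, Disjoint U W := fun W hW =>
    hC'.2 hU (hsub hW) (fun h => hUC (h ▸ hW))
  have hVC : V ∈ C := by
    refine hmax (y := insert V C) ⟨insert_subset hV𝒱 hCV, ?_⟩ (subset_insert V C)
      (mem_insert V C)
    exact hdisj.insert fun W hW _ => (hUd W hW).mono_left hVU
  have hd : Disjoint V V := (hUd V hVC).mono_left hVU
  exact (hV V hV𝒱).2.ne_empty (disjoint_self.1 hd)

/-- Every non-empty open set meets some member of a maximal cellular family. -/
theorem exists_mem_inter_nonempty_of_mem_maximalCellularFamilies {X : Type u}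
    [TopologicalSpace X] {C : Set (Set X)} (hC : C ∈ maximalCellularFamilies X) {U : Set X}
    (hU : IsOpen U) (hne : U.Nonempty) : ∃ V ∈ C, (U ∩ V).Nonempty := by
  by_contra! h
  have hins : insert U C = C := by
    refine hC.2 _ ⟨?_, ?_⟩ (subset_insert U C)
    · rintro W (rfl | hW)
      · exact ⟨hU, hne⟩
      · exact hC.1.1 W hW
    · exact hC.1.2.insert fun W hW _ => disjoint_iff_inter_eq_empty.2 (h W hW)
  have := h U (hins ▸ mem_insert U C)
  rw [inter_self] at this
  exact hne.ne_empty this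

theorem nonempty_of_p2WinsG1 {X : Type u} [TopologicalSpace X] {B : Set (Set (Set X))}
    (h : P2WinsG1 X ℕ (maximalCellularFamilies X) B) : Nonempty X := by
  obtain ⟨σ, hσ⟩ := h
  obtain ⟨C, hC, -⟩ := exists_maximalCellularFamily_subset {U : Set X | IsOpen U ∧ U.Nonempty}
    (fun _ h => h) (fun U h h' => ⟨U, ⟨h, h'⟩, Subset.rfl⟩)
  exact (hC.1.1 _ ((hσ (fun _ => C) fun _ => hC).1 0)).2.to_subtype.map Subtype.val

/-- The list of choices of a player who answers the move `p n` by applying `f` to it and to the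
list of the earlier choices. -/
def responseHistory {α β : Type*} (f : List β → α → β) (p : ℕ → α) : ℕ → List β
  | 0 => []
  | n + 1 => responseHistory f p n ++ [f (responseHistory f p n) (p n)]

theorem responseHistory_congr {α β : Type*} (f : List β → α → β) {p q : ℕ → α} (n : ℕ)
    (h : ∀ k < n, p k = q k) : responseHistory f p n = responseHistory f q n := by
  induction n with
  | zero => rfl
  | succ n ih =>
    simp only [responseHistory, ih fun k hk => h k (by omega), h n (by omega)]

theorem responseHistory_eq_map_range {α β : Type*} (f : List β → α → β) (p : ℕ → α) (n : ℕ) :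
    responseHistory f p n =
      (List.range n).map fun k => f (responseHistory f p k) (p k) := by
  induction n with
  | zero => rfl
  | succ n ih =>
    conv_lhs => rw [responseHistory]
    rw [List.range_succ, List.map_append, ← ih]
    rfl

/-- A winning strategy `s` for the player choosing first in the open-open game yields a winning
strategy for player two in `G^ω_1(𝒞_X, 𝒟_X)`. -/
theorem p2WinsG1_of_openOpen {X : Type u} [TopologicalSpace X] (s : List (Set X) → Set X)
    (hs : ∀ H, IsOpen (s H) ∧ (s H).Nonempty)
    (hwin : ∀ V : ℕ → Set X, (∀ n, IsOpen (V n) ∧ (V n).Nonempty ∧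
      V n ⊆ s ((List.range n).map V)) → Dense (⋃ n, V n)) :
    P2WinsG1 X ℕ (maximalCellularFamilies X) (denseFamilies X) := by
  have key : ∀ (H : List (Set X)) (C : Set (Set X)), ∃ V, C ∈ maximalCellularFamilies X →
      V ∈ C ∧ (s H ∩ V).Nonempty := by
    intro H C
    by_cases hC : C ∈ maximalCellularFamilies X
    · obtain ⟨V, hV⟩ := exists_mem_inter_nonempty_of_mem_maximalCellularFamilies hC
        (hs H).1 (hs H).2
      exact ⟨V, fun _ => hV⟩
    · exact ⟨∅, fun h => absurd h hC⟩
  choose r hr using key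
  let f : List (Set X) → Set (Set X) → Set X := fun H C => s H ∩ r H C
  refine ⟨fun n h => r (responseHistory f (fun k => if hk : k ≤ n then h ⟨k, hk⟩ else ∅) n)
    (h ⟨n, le_rfl⟩), fun p hp => ?_⟩
  have hcongr : ∀ n, responseHistory f (fun k => if _ : k ≤ n then p k else ∅) n =
      responseHistory f p n := fun n =>
    responseHistory_congr f n fun k hk => by simp [hk.le]
  simp only [hcongr]
  have hr' : ∀ n, _ := fun n => hr (responseHistory f p n) (p n) (hp n)
  refine ⟨fun n => (hr' n).1, ?_, ?_⟩
  · rintro _ ⟨n, rfl⟩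
    exact ((hp n).1.1 _ (hr' n).1).1
  · refine (hwin (fun n => f (responseHistory f p n) (p n)) fun n => ⟨?_, (hr' n).2, ?_⟩).mono ?_
    · exact (hs _).1.inter ((hp n).1.1 _ (hr' n).1).1
    · rw [← responseHistory_eq_map_range]
      exact inter_subset_left
    · rw [sUnion_range]
      exact iUnion_mono fun n => inter_subset_right

/-- At every position some non-empty open set `U` is such that player two can be forced to choose
inside any given non-empty open subset of `U`. -/
theorem exists_open_forcing {X : Type u} [TopologicalSpace X]
    (τ : maximalCellularFamilies X → Set X) (hτ : ∀ C, τ C ∈ C.1) :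
    ∃ U : Set X, IsOpen U ∧ U.Nonempty ∧
      ∀ V : Set X, IsOpen V → V.Nonempty → V ⊆ U → ∃ C, τ C ⊆ V := by
  by_contra! h
  obtain ⟨C, hC, hsub⟩ := exists_maximalCellularFamily_subset
    {V : Set X | (IsOpen V ∧ V.Nonempty) ∧ ∀ C, ¬ τ C ⊆ V} (fun _ h => h.1) (fun U hU hne => by
      obtain ⟨V, h1, h2, h3, h4⟩ := h U hU hne
      exact ⟨V, ⟨⟨h1, h2⟩, h4⟩, h3⟩)
  exact (hsub (hτ ⟨C, hC⟩)).2 ⟨C, hC⟩ Subset.rfl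

/-- A regular space of countable π-character in which player two wins `G^ω_1(𝒞_X, 𝒟_X)` has a
countable π-base. -/
theorem exists_countable_piBase_of_p2WinsG1 {X : Type u} [TopologicalSpace X] [RegularSpace X]
    (hπχ : ∀ x : X, ∃ B : Set (Set X), B.Countable ∧ IsLocalPiBase X x B)
    (hwin : P2WinsG1 X ℕ (maximalCellularFamilies X) (denseFamilies X)) :
    ∃ P : ℕ → Set X, (∀ n, IsOpen (P n) ∧ (P n).Nonempty) ∧
      ∀ U : Set X, IsOpen U → U.Nonempty → ∃ n, P n ⊆ U := by
  have hX := nonempty_of_p2WinsG1 hwin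
  have hb : ∀ x : X, ∃ b : ℕ → Set X, (∀ n, IsOpen (b n) ∧ (b n).Nonempty) ∧
      ∀ U : Set X, IsOpen U → x ∈ U → ∃ n, b n ⊆ U := by
    intro x
    obtain ⟨B, hBc, hB, hBU⟩ := hπχ x
    obtain ⟨V, hV, -⟩ := hBU univ isOpen_univ trivial
    obtain ⟨b, rfl⟩ := hBc.exists_eq_range ⟨V, hV⟩
    refine ⟨b, fun n => hB _ (mem_range_self n), fun U hU hx => ?_⟩
    obtain ⟨_, ⟨n, rfl⟩, hn⟩ := hBU U hU hx
    exact ⟨n, hn⟩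
  choose b hbo hbU using hb
  obtain ⟨σ, hσ⟩ := hwin
  let 𝒞 := maximalCellularFamilies X
  let τ : List 𝒞 → 𝒞 → Set X := fun q C => σ q.length fun γ => ((q ++ [C]).getD γ.1 C).1
  have hτ : ∀ q C, τ q C ∈ C.1 := by
    intro q C
    have := (hσ (fun k => ((q ++ [C]).getD k C).1) fun k => Subtype.prop _).1 q.length
    simpa [τ, List.getD_eq_getElem?_getD] using this
  choose U hUo hUne hUC using fun q => exists_open_forcing (τ q) (hτ q)
  choose x hx using hUne
  have hC : ∀ (q : List 𝒞) (m : ℕ), ∃ C : 𝒞, b (x q) m ⊆ U q → τ q C ⊆ b (x q) m := by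
    intro q m
    by_cases h : b (x q) m ⊆ U q
    · obtain ⟨C, hC⟩ := hUC q _ (hbo _ m).1 (hbo _ m).2 h
      exact ⟨C, fun _ => hC⟩
    · obtain ⟨C, -⟩ := hUC q _ (hUo q) ⟨_, hx q⟩ Subset.rfl
      exact ⟨C, fun h' => absurd h' h⟩
  choose c hc using hC
  let Q : List ℕ → List 𝒞 := List.rec [] fun m _ q => q ++ [c q m]
  have hdense : Dense (range fun l => x (Q l)) := by
    by_contra hD
    obtain ⟨y, hy⟩ : ∃ y, y ∉ closure (range fun l => x (Q l)) := by
      simpa [Dense] using hD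
    obtain ⟨K, ⟨hK, hKc⟩, hKD⟩ := (closed_nhds_basis y).mem_iff.1
      (isClosed_closure.isOpen_compl.mem_nhds hy)
    have hm : ∀ l, ∃ m, b (x (Q l)) m ⊆ U (Q l) ∩ Kᶜ := fun l =>
      hbU _ _ ((hUo _).inter hKc.isOpen_compl)
        ⟨hx _, fun h => hKD h (subset_closure (mem_range_self l))⟩
    choose m hm using hm
    let L : ℕ → List ℕ := fun n => Nat.rec [] (fun _ l => m l :: l) n
    let p : ℕ → 𝒞 := fun n => c (Q (L n)) (m (L n))
    have hQ : ∀ n, Q (L n) = (List.range n).map p := by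
      intro n
      induction n with
      | zero => rfl
      | succ n ih =>
        rw [List.range_succ, List.map_append, ← ih]
        rfl
    have hmove : ∀ n, σ n (fun γ => (p γ.1).1) = τ (Q (L n)) (p n) := by
      intro n
      have hlen : (Q (L n)).length = n := by simp [hQ]
      have hget : ∀ k ≤ n, (Q (L n) ++ [p n]).getD k (p n) = p k := by
        intro k hk
        have h1 : Q (L n) ++ [p n] = (List.range (n + 1)).map p := by
          rw [List.range_succ, List.map_append, ← hQ]
          rfl
        rw [h1]
        simp [List.getD_eq_getElem?_getD, List.getElem?_range (Nat.lt_succ_of_le hk)]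
      change _ = σ (Q (L n)).length _
      generalize hq : Q (L n) = q at *
      subst hlen
      congr 1
      funext γ
      exact congrArg Subtype.val (hget γ.1 γ.2).symm
    have hd := ((hσ (fun n => (p n).1) fun n => (p n).2).2).2
    obtain ⟨z, hzK, _, ⟨n, rfl⟩, hz⟩ :=
      hd.inter_open_nonempty _ isOpen_interior ⟨y, mem_interior_iff_mem_nhds.2 hK⟩
    simp only [hmove] at hz
    exact (hm (L n) (hc _ _ ((hm (L n)).trans inter_subset_left) hz)).2 (interior_subset hzK)
  obtain ⟨e, he⟩ := exists_surjective_nat (List ℕ × ℕ)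
  refine ⟨fun n => b (x (Q (e n).1)) (e n).2, fun n => hbo _ _, fun O hO hne => ?_⟩
  obtain ⟨_, hz, l, rfl⟩ := hdense.inter_open_nonempty O hO hne
  obtain ⟨k, hk⟩ := hbU _ O hO hz
  obtain ⟨n, hn⟩ := he (l, k)
  exact ⟨n, by simpa [hn] using hk⟩

/-- A non-empty open subset of a product contains every point agreeing with some fixed point on
some finite set of coordinates. -/
theorem exists_finset_forall_eq_mem_of_isOpen {I : Type u} {X : I → Type v}
    [∀ i, TopologicalSpace (X i)] {V : Set (∀ i, X i)} (hV : IsOpen V) (hne : V.Nonempty) :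
    ∃ (F : Finset I) (y : ∀ i, X i), ∀ z : ∀ i, X i, (∀ i ∈ F, z i = y i) → z ∈ V := by
  obtain ⟨y, hy⟩ := hne
  obtain ⟨F, u, hu, hsub⟩ := isOpen_pi_iff.1 hV y hy
  exact ⟨F, y, fun z hz => hsub fun i hi => by rw [hz i hi]; exact (hu i hi).2⟩

/-- Player two wins `G^ω_1(𝒞_X, 𝒟_X)` on products of spaces with countable π-bases. -/
theorem p2WinsG1_pi_of_countable_piBase {I : Type u} {X : I → Type v}
    [∀ i, TopologicalSpace (X i)] (P : ∀ i, ℕ → Set (X i))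
    (hP : ∀ i n, IsOpen (P i n) ∧ (P i n).Nonempty)
    (hPU : ∀ i, ∀ U : Set (X i), IsOpen U → U.Nonempty → ∃ n, P i n ⊆ U)
    (hX : ∀ i, Nonempty (X i)) :
    P2WinsG1 (∀ i, X i) ℕ (maximalCellularFamilies (∀ i, X i))
      (denseFamilies (∀ i, X i)) := by
  classical
  have hsupp : ∀ V : Set (∀ i, X i), ∃ (F : Finset I) (y : ∀ i, X i),
      IsOpen V ∧ V.Nonempty → ∀ z : ∀ i, X i, (∀ i ∈ F, z i = y i) → z ∈ V := by
    intro V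
    by_cases h : IsOpen V ∧ V.Nonempty
    · obtain ⟨F, y, hy⟩ := exists_finset_forall_eq_mem_of_isOpen h.1 h.2
      exact ⟨F, y, fun _ => hy⟩
    · exact ⟨∅, fun i => (hX i).some, fun h' => absurd h' h⟩
  choose F y hFy using hsupp
  choose e he using fun J : Finset I => exists_surjective_nat (J → ℕ)
  let box : (J : Finset I) → (J → ℕ) → Set (∀ i, X i) := fun J f =>
    {z | ∀ j : J, z j ∈ P j (f j)}
  have hbox : ∀ J f, IsOpen (box J f) ∧ (box J f).Nonempty := by
    intro J f
    constructor
    · simp only [box, ofPred_forall]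
      exact isOpen_iInter_of_finite fun j => (hP _ _).1.preimage (continuous_apply j.1)
    · refine ⟨fun i => if h : i ∈ J then (hP i (f ⟨i, h⟩)).2.some else (hX i).some, fun j => ?_⟩
      simpa using (hP j.1 (f j)).2.some_mem
  let J : List (Set (∀ i, X i)) → Finset I := fun H => H.toFinset.biUnion F
  refine p2WinsG1_of_openOpen (fun H => box (J (H.take H.length.unpair.1)) (e _ H.length.unpair.2))
    (fun H => hbox _ _) fun V hV => ?_
  rw [dense_iff_inter_open]
  rintro O hO ⟨x, hx⟩
  obtain ⟨G, u, hu, hGO⟩ := isOpen_pi_iff.1 hO x hx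
  have hk : ∀ i, ∃ k, (∃ k', i ∈ F (V k')) → i ∈ F (V k) := by
    intro i
    by_cases h : ∃ k', i ∈ F (V k')
    · exact ⟨h.choose, fun _ => h.choose_spec⟩
    · exact ⟨0, fun h' => absurd h' h⟩
  choose k hk using hk
  let a := G.sup fun i => k i + 1
  have hf : ∀ i, ∃ m, i ∈ G → P i m ⊆ u i := by
    intro i
    by_cases h : i ∈ G
    · obtain ⟨m, hm⟩ := hPU i (u i) (hu i h).1 ⟨x i, (hu i h).2⟩
      exact ⟨m, fun _ => hm⟩
    · exact ⟨0, fun h' => absurd h' h⟩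
  choose f hf using hf
  obtain ⟨c, hc⟩ := he (J ((List.range a).map V)) fun j => f j
  let n := Nat.pair a c
  have hsub : V n ⊆ box (J ((List.range a).map V)) fun j => f j := by
    have h := (hV n).2.2
    have hlen : ((List.range n).map V).length.unpair = (a, c) := by simp [n]
    have htake : ((List.range n).map V).take a = (List.range a).map V := by
      rw [← List.map_take, List.take_range, min_eq_left (Nat.left_le_pair a c)]
    beta_reduce at h
    rw [hlen, htake, hc] at h
    exact h
  have hy := hFy (V n) ⟨(hV n).1, (hV n).2.1⟩
  let z : ∀ i, X i := fun i => if ∃ k', i ∈ F (V k') then y (V n) i else x i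
  refine ⟨z, hGO fun i hi => ?_, mem_iUnion.2 ⟨n, hy z fun i hi => if_pos ⟨n, hi⟩⟩⟩
  by_cases h : ∃ k', i ∈ F (V k')
  · have hiJ : i ∈ J ((List.range a).map V) := by
      have hka : k i < a := Finset.le_sup (f := fun i => k i + 1) hi
      simp only [J, Finset.mem_biUnion, List.mem_toFinset, List.mem_map, List.mem_range]
      exact ⟨_, ⟨k i, hka, rfl⟩, hk i h⟩
    have hzi : z i = y (V n) i := if_pos h
    rw [hzi]
    exact hf i hi (hsub (hy _ fun _ _ => rfl) ⟨i, hiJ⟩)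
  · have hzi : z i = x i := if_neg h
    rw [hzi]
    exact (hu i hi).2

theorem stmt_18 {I : Type u} {X : I → Type v} [∀ i, TopologicalSpace (X i)]
    [∀ i, RegularSpace (X i)]
    (hπχ : ∀ i, ∀ x : X i, ∃ B : Set (Set (X i)), B.Countable ∧ IsLocalPiBase (X i) x B)
    (hwin : ∀ i, P2WinsG1 (X i) ℕ (maximalCellularFamilies (X i)) (denseFamilies (X i))) :
    P2WinsG1 (∀ i, X i) ℕ (maximalCellularFamilies (∀ i, X i))
      (denseFamilies (∀ i, X i)) := by
  choose P hP hPU using fun i => exists_countable_piBase_of_p2WinsG1 (hπχ i) (hwin i)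
  exact p2WinsG1_pi_of_countable_piBase P hP hPU fun i => nonempty_of_p2WinsG1 (hwin i)
end
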